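/- arXiv:1203.4867 — 5 statements merged into one kernel-verified Lean document; each statement's English description precedes it below -/
import Mathlib

section
/- For all real numbers S ≥ 0 and E ≥ 1, (1/2)·log₂(1 + S/(E+1)) ≥ (1/2)·log₂(1 + S/E) − 1/2. -/
/-- Theorem 3, upper-layer-noise-dominant case: for `S ≥ 0` and `E ≥ 1`,
`C(S/(E+1)) ≥ C(S/E) − 1/2` where `C(x) = (1/2)·log₂(1+x)`. -/
theorem stmt_4 (S E : ℝ) (hS : 0 ≤ S) (hE : 1 ≤ E) :
    (1 / 2 : ℝ) * Real.logb 2 (1 + S / (E + 1)) ≥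
      (1 / 2 : ℝ) * Real.logb 2 (1 + S / E) - 1 / 2 := by
  have hE0 : 0 < E := by linarith
  have hpos : 0 < 1 + S / (E + 1) := by positivity
  have hsnr : S / E ≤ 2 * (S / (E + 1)) := by
    rw [← mul_div_assoc, div_le_div_iff₀ hE0 (by linarith)]
    nlinarith
  have hlog : Real.logb 2 (1 + S / E) ≤ Real.logb 2 (2 * (1 + S / (E + 1))) :=
    Real.logb_le_logb_of_le one_lt_two (by positivity) (by linarith)
  rw [Real.logb_mul two_ne_zero hpos.ne', Real.logb_self_eq_one one_lt_two] at hlog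
  linarith
end

section
/- Let α, β be real numbers with 0 ≤ α ≤ β ≤ π/2. Then for every θ ∈ ℝ there exists θ' ∈ [α, β] such that cos²(θ' − α) ≥ cos²(θ − α) and cos²(θ' − β) ≥ cos²(θ − β). -/
open Real

theorem cos_sq_sub_int_mul_pi (x : ℝ) (n : ℤ) :
    Real.cos (x - n * π) ^ 2 = Real.cos x ^ 2 := by
  have h : Function.Periodic (fun y : ℝ => Real.cos y ^ 2) π := fun y => by
    simp [Real.cos_add_pi]
  exact h.sub_int_mul_eq n

theorem cos_sq_le_cos_sq {u v : ℝ} (h₁ : 0 ≤ v - u) (h₂ : v - u ≤ π)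
    (h₃ : 0 ≤ v + u) (h₄ : v + u ≤ π) : Real.cos v ^ 2 ≤ Real.cos u ^ 2 := by
  have h := mul_nonneg (Real.sin_nonneg_of_nonneg_of_le_pi h₁ h₂)
    (Real.sin_nonneg_of_nonneg_of_le_pi h₃ h₄)
  rw [Real.sin_sub, Real.sin_add] at h
  nlinarith [Real.sin_sq_add_cos_sq u, Real.sin_sq_add_cos_sq v]

/-- Lemma 3: for `0 ≤ α ≤ β ≤ π/2` and any `θ`, some `θ' ∈ [α, β]` dominates `θ`:
`cos²(θ'−α) ≥ cos²(θ−α)` and `cos²(θ'−β) ≥ cos²(θ−β)`. -/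
theorem stmt_12 (α β : ℝ) (hα : 0 ≤ α) (hαβ : α ≤ β) (hβ : β ≤ π / 2) :
    ∀ θ : ℝ, ∃ θ' ∈ Set.Icc α β,
      Real.cos (θ - α) ^ 2 ≤ Real.cos (θ' - α) ^ 2 ∧
      Real.cos (θ - β) ^ 2 ≤ Real.cos (θ' - β) ^ 2 := by
  intro θ
  obtain ⟨n, ⟨hn₀, hn₁⟩, -⟩ := existsUnique_sub_zsmul_mem_Ico Real.pi_pos θ α
  rw [zsmul_eq_mul] at hn₀ hn₁
  rw [← cos_sq_sub_int_mul_pi (θ - α) n, ← cos_sq_sub_int_mul_pi (θ - β) n,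
    sub_right_comm θ α, sub_right_comm θ β]
  generalize θ - n * π = φ at hn₀ hn₁ ⊢
  rcases le_total φ β with h | h
  · exact ⟨φ, ⟨hn₀, h⟩, le_rfl, le_rfl⟩
  rcases le_total (φ - α) (π - (β - α)) with h' | h'
  · refine ⟨β, ⟨hαβ, le_rfl⟩, ?_, ?_⟩
    · apply cos_sq_le_cos_sq <;> linarith
    · simpa using Real.cos_sq_le_one (φ - β)
  · -- Past `π - (β - α)`, reflect `φ - π` about `α`.
    refine ⟨2 * α + π - φ, ⟨by linarith, by linarith⟩, ?_, ?_⟩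
    · rw [show 2 * α + π - φ - α = π - (φ - α) by ring, Real.cos_pi_sub, neg_sq]
    · apply cos_sq_le_cos_sq <;> linarith
end

section
/- Let P₁ ≥ 0, P₂ ≥ 0 be real and let α, β be real numbers with α ≤ β and β − α ≤ π/4. Then the function φ(θ) = P₁·cos²(θ − α) + P₂·cos²(θ − β) is concave on the interval [α, β]. -/
open Real

/-- `cos²(θ - c)` is concave in `θ` on the interval of radius `π / 4` around `c`. -/
theorem concaveOn_cos_sub_sq (c : ℝ) :
    ConcaveOn ℝ (Set.Icc (c - π / 4) (c + π / 4)) (fun θ : ℝ => Real.cos (θ - c) ^ 2) := by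
  refine ⟨convex_Icc _ _, fun x hx y hy a b ha hb hab => ?_⟩
  have key := strictConcaveOn_cos_Icc.concaveOn.2
    (x := 2 * (x - c)) ⟨by linarith [hx.1], by linarith [hx.2]⟩
    (y := 2 * (y - c)) ⟨by linarith [hy.1], by linarith [hy.2]⟩ ha hb hab
  have harg : a * (2 * (x - c)) + b * (2 * (y - c)) = 2 * (a * x + b * y - c) := by
    linear_combination (-2 * c) * hab
  simp only [smul_eq_mul, harg] at key
  simp only [smul_eq_mul, Real.cos_sq]
  linear_combination key / 2 + hab / 2

/-- Lemma 4: for `P₁, P₂ ≥ 0` and `α ≤ β` with `β − α ≤ π/4`, the function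
`φ(θ) = P₁·cos²(θ−α) + P₂·cos²(θ−β)` is concave on `[α, β]`. -/
theorem stmt_13 (P₁ P₂ α β : ℝ) (hP₁ : 0 ≤ P₁) (hP₂ : 0 ≤ P₂)
    (hαβ : α ≤ β) (h : β - α ≤ π / 4) :
    ConcaveOn ℝ (Set.Icc α β)
      (fun θ : ℝ => P₁ * Real.cos (θ - α) ^ 2 + P₂ * Real.cos (θ - β) ^ 2) := by
  have hα : ConcaveOn ℝ (Set.Icc α β) (fun θ : ℝ => Real.cos (θ - α) ^ 2) :=
    (concaveOn_cos_sub_sq α).subset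
      (Set.Icc_subset_Icc (by linarith) (by linarith)) (convex_Icc _ _)
  have hβ : ConcaveOn ℝ (Set.Icc α β) (fun θ : ℝ => Real.cos (θ - β) ^ 2) :=
    (concaveOn_cos_sub_sq β).subset
      (Set.Icc_subset_Icc (by linarith) (by linarith)) (convex_Icc _ _)
  exact (hα.smul hP₁).add (hβ.smul hP₂)
end

section
/- Let I ⊆ ℝ be a convex set (an interval) and let f₁, f₂, g : I → ℝ be concave functions on I. Then the union over θ ∈ I of the sets {(x, y) ∈ ℝ² : 0 ≤ x, 0 ≤ y, x ≤ f₁(θ), y ≤ f₂(θ), x + y ≤ g(θ)} is a convex subset of ℝ². -/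
/-- Abstract convexity fact behind Lemma 4 / Theorem 5: if `f₁, f₂, g` are concave on a
convex set `I ⊆ ℝ`, then the union over `θ ∈ I` of the pentagons
`{(x, y) : 0 ≤ x, 0 ≤ y, x ≤ f₁ θ, y ≤ f₂ θ, x + y ≤ g θ}` is convex. -/
theorem stmt_14 (I : Set ℝ) (hI : Convex ℝ I) (f₁ f₂ g : ℝ → ℝ)
    (hf₁ : ConcaveOn ℝ I f₁) (hf₂ : ConcaveOn ℝ I f₂) (hg : ConcaveOn ℝ I g) :
    Convex ℝ (⋃ θ ∈ I,
      {p : ℝ × ℝ | 0 ≤ p.1 ∧ 0 ≤ p.2 ∧ p.1 ≤ f₁ θ ∧ p.2 ≤ f₂ θ ∧ p.1 + p.2 ≤ g θ}) := by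
  intro p hp q hq a b ha hb hab
  simp only [Set.mem_iUnion, Set.mem_ofPred_eq, exists_prop] at hp hq ⊢
  obtain ⟨s, hs, hp₁, hp₂, hp₃, hp₄, hp₅⟩ := hp
  obtain ⟨t, ht, hq₁, hq₂, hq₃, hq₄, hq₅⟩ := hq
  have h₁ := hf₁.2 hs ht ha hb hab
  have h₂ := hf₂.2 hs ht ha hb hab
  have h₃ := hg.2 hs ht ha hb hab
  refine ⟨a • s + b • t, hI hs ht ha hb hab, ?_⟩
  simp only [Prod.fst_add, Prod.snd_add, Prod.smul_fst, Prod.smul_snd, smul_eq_mul]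
    at h₁ h₂ h₃ ⊢
  refine ⟨by positivity, by positivity, le_trans (by gcongr) h₁, le_trans (by gcongr) h₂, ?_⟩
  calc a * p.1 + b * q.1 + (a * p.2 + b * q.2)
      = a * (p.1 + p.2) + b * (q.1 + q.2) := by ring
    _ ≤ a * g s + b * g t := by gcongr
    _ ≤ g (a * s + b * t) := h₃
end

section
/- Let P₁ ≥ 0, P₂ ≥ 0 and let α, β, θ be real numbers with 0 ≤ α ≤ θ ≤ β ≤ π/2. Then (−P₁·sin(2(θ−α)) − P₂·sin(2(θ−β)))·(1 + P₂·cos²(θ−β)) + P₂·sin(2(θ−β))·(1 + P₁·cos²(θ−α) + P₂·cos²(θ−β)) ≤ 0. -/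
open Real

/-- Nonpositivity of `g₂(θ) = φ'(θ)(1+φ₂(θ)) − φ₂'(θ)(1+φ(θ))` on `[α, β]`
(equation (103)) for `0 ≤ α ≤ θ ≤ β ≤ π/2` and `P₁, P₂ ≥ 0`. -/
theorem stmt_18 (P₁ P₂ α β θ : ℝ) (hP₁ : 0 ≤ P₁) (hP₂ : 0 ≤ P₂)
    (hα : 0 ≤ α) (hαθ : α ≤ θ) (hθβ : θ ≤ β) (hβ : β ≤ π / 2) :
    (-P₁ * Real.sin (2 * (θ - α)) - P₂ * Real.sin (2 * (θ - β))) *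
        (1 + P₂ * Real.cos (θ - β) ^ 2) +
      P₂ * Real.sin (2 * (θ - β)) *
        (1 + P₁ * Real.cos (θ - α) ^ 2 + P₂ * Real.cos (θ - β) ^ 2) ≤ 0 := by
  have hsα : 0 ≤ sin (2 * (θ - α)) := sin_nonneg_of_nonneg_of_le_pi (by linarith) (by linarith)
  have hsβ : sin (2 * (θ - β)) ≤ 0 := sin_nonpos_of_nonpos_of_neg_pi_le (by linarith) (by linarith)
  have h₁ : 0 ≤ P₁ * sin (2 * (θ - α)) * (1 + P₂ * cos (θ - β) ^ 2) := by positivity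
  have h₂ : P₁ * P₂ * cos (θ - α) ^ 2 * sin (2 * (θ - β)) ≤ 0 :=
    mul_nonpos_of_nonneg_of_nonpos (by positivity) hsβ
  linear_combination h₂ + h₁
end
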